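/- Intrinsic Matrix Chernoff bound for ℓ∞-independent homogeneous point processes: Let X be a point process on {1,…,m} that is k-homogeneous and ℓ∞-independent with parameter d_inf. Let Y_1,…,Y_m be d×d Hermitian matrices with 0 ⪯ Y_i ⪯ rI for all i and some r > 0, and assume E_X[Σ_{i∈X} Y_i] ⪯ M for some nonzero positive semidefinite Hermitian matrix M. Let intdim(M) = Tr(M)/‖M‖_op, κ = ‖M‖_op, and c = max(r·d_inf, (r/2)·(9·d_inf² + 1)). Then for all ε ∈ (0,1], Pr[‖Σ_{i∈X} Y_i − E_X[Σ_{i∈X} Y_i]‖_op ≥ εκ] ≤ 2·intdim(M)·(1 + 12c²/(κ²ε⁴))·exp(−ε²κ/(4c)). -/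

import Mathlib

open Matrix Finset
open scoped Classical ComplexOrder

/-- Operator norm of a square complex matrix (largest singular value). -/
noncomputable def opNorm {k : ℕ} (A : Matrix (Fin k) (Fin k) ℂ) : ℝ :=
  ‖Matrix.toEuclideanCLM (𝕜 := ℂ) A‖

/-- Intensity of a point process: `ρ_X(i) = Pr(i ∈ X)`. -/
noncomputable def intensity {α : Type*} [Fintype α] [DecidableEq α]
    (μ : Finset α → ℝ) (i : α) : ℝ :=
  ∑ F ∈ Finset.univ.filter (fun F => i ∈ F), μ F

/-- Normalizing constant of the reduced process `X_{A1}^{A0}`. -/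
noncomputable def redNorm {α : Type*} [Fintype α] [DecidableEq α]
    (μ : Finset α → ℝ) (A0 A1 : Finset α) : ℝ :=
  ∑ B ∈ Finset.univ.filter (fun B => Disjoint B (A0 ∪ A1)), μ (A1 ∪ B)

/-- The reduced process `X_{A1}^{A0}` obtained from `μ` by excluding `A0` and
including `A1`: its law on subsets `B` of the complement of `A0 ∪ A1` is
proportional to `μ (A1 ∪ B)`. -/
noncomputable def reduced {α : Type*} [Fintype α] [DecidableEq α]
    (μ : Finset α → ℝ) (A0 A1 : Finset α) : Finset α → ℝ :=
  fun B => if Disjoint B (A0 ∪ A1) then μ (A1 ∪ B) / redNorm μ A0 A1 else 0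

/-- `δ_{X,e}(i) = 1 - ρ_X(e)` if `i = e`, and `ρ_{X_e}(i) - ρ_X(i)` otherwise. -/
noncomputable def deltaPP {α : Type*} [Fintype α] [DecidableEq α]
    (μ : Finset α → ℝ) (e i : α) : ℝ :=
  if i = e then 1 - intensity μ e else intensity (reduced μ ∅ {e}) i - intensity μ i

/-- A point process is `k`-homogeneous if all its samples have cardinality `k`. -/
def IsHomogeneous {α : Type*} (μ : Finset α → ℝ) (k : ℕ) : Prop :=
  ∀ F, μ F ≠ 0 → F.card = k

/-- `ℓ∞`-independence with parameter `dinf`: for all disjoint `A0, A1` such that the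
reduced process `Y = X_{A1}^{A0}` exists, and all `e` in the support of the intensity
of `Y`, the total variation `∑_{i ∈ supp ρ_Y} |δ_{Y,e}(i)|` is at most `dinf`. -/
def LinftyIndep {α : Type*} [Fintype α] [DecidableEq α]
    (μ : Finset α → ℝ) (dinf : ℝ) : Prop :=
  ∀ A0 A1 : Finset α, Disjoint A0 A1 → redNorm μ A0 A1 ≠ 0 →
    ∀ e : α, intensity (reduced μ A0 A1) e ≠ 0 →
      ∑ i ∈ Finset.univ.filter (fun i => intensity (reduced μ A0 A1) i ≠ 0),
        |deltaPP (reduced μ A0 A1) e i| ≤ dinf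

section TraceInequalities

open scoped MatrixOrder Matrix.Norms.L2Operator

variable {n : Type*} [Fintype n] [DecidableEq n]

/-- The trace of a product of two positive semidefinite matrices is nonnegative. -/
lemma trace_mul_re_nonneg {A B : Matrix n n ℂ} (hA : A.PosSemidef) (hB : B.PosSemidef) :
    0 ≤ (A * B).trace.re := by
  obtain ⟨C, rfl⟩ := CStarAlgebra.nonneg_iff_eq_star_mul_self.mp hA.nonneg
  rw [Matrix.star_eq_conjTranspose, Matrix.mul_assoc, Matrix.trace_mul_comm]
  exact (Complex.nonneg_iff.mp (hB.mul_mul_conjTranspose_same C).trace_nonneg).1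

/-- Cauchy–Schwarz for the trace pairing, in arithmetic-mean form. -/
lemma two_mul_trace_mul_re_le {n : Type*} [Fintype n] (A B : Matrix n n ℂ) :
    2 * (A * B).trace.re ≤ (A * Aᴴ).trace.re + (Bᴴ * B).trace.re := by
  have h := (Complex.nonneg_iff.mp
    (Matrix.posSemidef_self_mul_conjTranspose (A - Bᴴ)).trace_nonneg).1
  have h1 : (Bᴴ * Aᴴ).trace.re = (A * B).trace.re := by
    rw [← Matrix.conjTranspose_mul, Matrix.trace_conjTranspose]; simp
  simp only [Matrix.conjTranspose_sub, Matrix.conjTranspose_conjTranspose, sub_mul, mul_sub,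
    Matrix.trace_sub, Complex.sub_re, h1] at h
  linarith

/-- Cyclicity of the trace for powers of a product. -/
lemma trace_mul_pow_comm (A B : Matrix n n ℂ) (N : ℕ) :
    ((A * B) ^ N).trace = ((B * A) ^ N).trace := by
  cases N with
  | zero => simp
  | succ N =>
    rw [pow_succ, ← mul_assoc, Matrix.trace_mul_comm, ← mul_assoc, ← mul_pow_mul, mul_assoc,
      ← pow_succ]

/-- Power inequalities for traces: `Re tr Z^(2N) ≤ tr (Z Z*)^N` and
`tr (AB)^N ≤ tr A^N B^N` for Hermitian `A`, `B` when `N` is a power of two. -/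
lemma trace_pow_two_pow_le (k : ℕ) :
    (∀ Z : Matrix n n ℂ, (Z ^ 2 ^ (k + 1)).trace.re ≤ ((Z * Zᴴ) ^ 2 ^ k).trace.re) ∧
    ∀ A B : Matrix n n ℂ, A.IsHermitian → B.IsHermitian →
      ((A * B) ^ 2 ^ k).trace.re ≤ (A ^ 2 ^ k * B ^ 2 ^ k).trace.re := by
  induction k with
  | zero =>
    refine ⟨fun Z => ?_, fun A B _ _ => by simp⟩
    have h := two_mul_trace_mul_re_le Z Z
    rw [Matrix.trace_mul_comm Zᴴ Z] at h
    simp only [zero_add, pow_one, pow_zero, pow_two]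
    linarith
  | succ k ih =>
    obtain ⟨ihZ, ihAB⟩ := ih
    constructor
    · intro Z
      set P := Zᴴ * Z with hP
      set Q := Z * Zᴴ with hQ
      have hPh : P.IsHermitian := Matrix.isHermitian_conjTranspose_mul_self Z
      have hQh : Q.IsHermitian := Matrix.isHermitian_mul_conjTranspose_self Z
      have h1 : (Z ^ 2 ^ (k + 1 + 1)).trace.re ≤ ((P * Q) ^ 2 ^ k).trace.re := by
        have h := ihZ (Z ^ 2)
        rw [← pow_mul, show 2 * 2 ^ (k + 1) = 2 ^ (k + 1 + 1) by ring] at h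
        refine h.trans_eq ?_
        have h2 : Z ^ 2 * (Z ^ 2)ᴴ = Z * (Q * Zᴴ) := by
          rw [Matrix.conjTranspose_pow, hQ]; noncomm_ring
        rw [h2, trace_mul_pow_comm, Matrix.mul_assoc, trace_mul_pow_comm]
      have h3 := ihAB P Q hPh hQh
      have h4 := two_mul_trace_mul_re_le (P ^ 2 ^ k) (Q ^ 2 ^ k)
      rw [Matrix.conjTranspose_pow, Matrix.conjTranspose_pow, hPh.eq, hQh.eq, ← pow_add,
        ← pow_add, show 2 ^ k + 2 ^ k = 2 ^ (k + 1) by ring, hP, hQ,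
        trace_mul_pow_comm Zᴴ Z] at h4
      rw [hP, hQ] at *
      linarith
    · intro A B hA hB
      refine (ihZ (A * B)).trans ?_
      have h := ihAB (A ^ 2) (B ^ 2) (hA.pow 2) (hB.pow 2)
      rw [← pow_mul, ← pow_mul, show 2 * 2 ^ k = 2 ^ (k + 1) by ring] at h
      refine le_trans (le_of_eq ?_) h
      rw [Matrix.conjTranspose_mul, hA.eq, hB.eq,
        show A * B * (B * A) = A * (B ^ 2 * A) by noncomm_ring, trace_mul_pow_comm,
        Matrix.mul_assoc, ← pow_two, trace_mul_pow_comm]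

end TraceInequalities

section LieTrotter

open Filter Topology

variable {𝔸 : Type*} [NormedRing 𝔸] [NormOneClass 𝔸] [NormedAlgebra ℝ 𝔸] [CompleteSpace 𝔸]

lemma norm_normedSpace_exp_le (x : 𝔸) : ‖NormedSpace.exp x‖ ≤ Real.exp ‖x‖ := by
  have h1 := NormedSpace.exp_series_hasSum_exp' (𝕂 := ℝ) x
  have h2 := NormedSpace.exp_series_hasSum_exp' (𝕂 := ℝ) ‖x‖
  rw [← Real.exp_eq_exp_ℝ] at h2
  refine h1.norm_le_of_bounded h2 fun i => ?_
  rw [norm_smul, smul_eq_mul, norm_inv, RCLike.norm_natCast]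
  gcongr
  exact norm_pow_le x i

lemma norm_pow_sub_pow_le {𝔸 : Type*} [NormedRing 𝔸] [NormOneClass 𝔸] {u v : 𝔸}
    {K : ℝ} (hK : 1 ≤ K) (hu : ‖u‖ ≤ K) (hv : ‖v‖ ≤ K) (N : ℕ) :
    ‖u ^ N - v ^ N‖ ≤ N * ‖u - v‖ * K ^ N := by
  induction N with
  | zero => simp
  | succ N ih =>
    have h : u ^ (N + 1) - v ^ (N + 1) = (u ^ N - v ^ N) * u + v ^ N * (u - v) := by
      rw [pow_succ, pow_succ]; noncomm_ring
    have hv' : ‖v ^ N‖ ≤ K ^ N := (norm_pow_le v N).trans (by gcongr)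
    have hK' : K ^ N ≤ K ^ (N + 1) := pow_le_pow_right₀ hK (by omega)
    have hd := norm_nonneg (u - v)
    calc ‖u ^ (N + 1) - v ^ (N + 1)‖ ≤ ‖u ^ N - v ^ N‖ * ‖u‖ + ‖v ^ N‖ * ‖u - v‖ := by
          rw [h]
          exact (norm_add_le _ _).trans (add_le_add (norm_mul_le _ _) (norm_mul_le _ _))
      _ ≤ (N * ‖u - v‖ * K ^ N) * K + K ^ (N + 1) * ‖u - v‖ := by
          gcongr
          exact hv'.trans hK'
      _ = _ := by push_cast; ring

/-- Lie–Trotter product formula. -/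
lemma tendsto_exp_mul_exp_pow (x y : 𝔸) :
    Tendsto (fun N : ℕ => (NormedSpace.exp ((N : ℝ)⁻¹ • x) * NormedSpace.exp ((N : ℝ)⁻¹ • y)) ^ N)
      atTop (𝓝 (NormedSpace.exp (x + y))) := by
  let f : ℝ → 𝔸 := fun t =>
    NormedSpace.exp (t • x) * NormedSpace.exp (t • y) - NormedSpace.exp (t • (x + y))
  have hf : HasDerivAt f 0 0 := by
    have h := ((hasDerivAt_exp_smul_const (𝕂 := ℝ) x 0).mul
      (hasDerivAt_exp_smul_const (𝕂 := ℝ) y 0)).sub (hasDerivAt_exp_smul_const (𝕂 := ℝ) (x + y) 0)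
    simp only [zero_smul, NormedSpace.exp_zero, one_mul, mul_one, sub_self] at h
    exact h
  have hlim : Tendsto (fun N : ℕ => (N : ℝ) * ‖f (N : ℝ)⁻¹‖) atTop (𝓝 0) := by
    have h0 : f 0 = 0 := by simp [f, NormedSpace.exp_zero]
    have h := hf.tendsto_slope_zero
    simp only [zero_add, h0, sub_zero] at h
    have hN : Tendsto (fun N : ℕ => (N : ℝ)⁻¹) atTop (𝓝[≠] 0) := by
      refine tendsto_nhdsWithin_iff.mpr ⟨tendsto_inv_atTop_nhds_zero_nat, ?_⟩
      filter_upwards [eventually_gt_atTop 0] with N hN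
      simpa using hN.ne'
    have := (h.comp hN).norm
    simpa [norm_smul, Function.comp_def] using this
  set C := Real.exp (‖x‖ + ‖y‖)
  rw [tendsto_iff_norm_sub_tendsto_zero]
  refine squeeze_zero' (Eventually.of_forall fun _ => norm_nonneg _) ?_
    (by simpa using hlim.mul_const C)
  filter_upwards [eventually_gt_atTop 0] with N hN
  have hN' : (0 : ℝ) < N := by exact_mod_cast hN
  have hpow : NormedSpace.exp (x + y) = NormedSpace.exp ((N : ℝ)⁻¹ • (x + y)) ^ N := by
    let : NormedAlgebra ℚ 𝔸 := NormedAlgebra.restrictScalars ℚ ℝ 𝔸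
    rw [← NormedSpace.exp_nsmul, ← Nat.cast_smul_eq_nsmul ℝ, smul_smul,
      mul_inv_cancel₀ hN'.ne', one_smul]
  set K := Real.exp ((N : ℝ)⁻¹ * (‖x‖ + ‖y‖))
  have hK : K ^ N = C := by
    rw [← Real.exp_nat_mul, ← mul_assoc, mul_inv_cancel₀ hN'.ne', one_mul]
  have hK1 : 1 ≤ K := Real.one_le_exp (by positivity)
  have hsm (z : 𝔸) : ‖(N : ℝ)⁻¹ • z‖ = (N : ℝ)⁻¹ * ‖z‖ := by
    rw [norm_smul, norm_inv, RCLike.norm_natCast]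
  have hu : ‖NormedSpace.exp ((N : ℝ)⁻¹ • x) * NormedSpace.exp ((N : ℝ)⁻¹ • y)‖ ≤ K := by
    refine (norm_mul_le _ _).trans ?_
    rw [show K = Real.exp ‖(N : ℝ)⁻¹ • x‖ * Real.exp ‖(N : ℝ)⁻¹ • y‖ by
      rw [← Real.exp_add, hsm, hsm, ← mul_add]]
    gcongr <;> exact norm_normedSpace_exp_le _
  have hv : ‖NormedSpace.exp ((N : ℝ)⁻¹ • (x + y))‖ ≤ K := by
    refine (norm_normedSpace_exp_le _).trans (Real.exp_le_exp.mpr ?_)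
    rw [hsm]
    gcongr
    exact norm_add_le x y
  have := norm_pow_sub_pow_le hK1 hu hv N
  rw [hK, ← hpow] at this
  exact this

end LieTrotter

section GoldenThompson

open scoped MatrixOrder Matrix.Norms.L2Operator
open Filter Topology

variable {n : Type*} [Fintype n] [DecidableEq n]

/-- **Golden–Thompson inequality.** -/
lemma trace_exp_add_re_le {A B : Matrix n n ℂ} (hA : A.IsHermitian) (hB : B.IsHermitian) :
    (NormedSpace.exp (A + B)).trace.re ≤ (NormedSpace.exp A * NormedSpace.exp B).trace.re := by
  cases isEmpty_or_nonempty n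
  · simp [Matrix.trace]
  have hlim := (tendsto_exp_mul_exp_pow A B).comp (tendsto_pow_atTop_atTop_of_one_lt one_lt_two)
  have hcont : Continuous fun Z : Matrix n n ℂ => Z.trace.re :=
    Complex.continuous_re.comp (continuous_id.matrix_trace)
  refine le_of_tendsto' ((hcont.tendsto _).comp hlim) fun k => ?_
  have hh {Z : Matrix n n ℂ} (hZ : Z.IsHermitian) :
      (NormedSpace.exp (((2 ^ k : ℕ) : ℝ)⁻¹ • Z)).IsHermitian :=
    Matrix.IsHermitian.exp (hZ.smul (IsSelfAdjoint.all _))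
  refine ((trace_pow_two_pow_le k).2 _ _ (hh hA) (hh hB)).trans_eq ?_
  have hp (Z : Matrix n n ℂ) :
      NormedSpace.exp (((2 ^ k : ℕ) : ℝ)⁻¹ • Z) ^ 2 ^ k = NormedSpace.exp Z := by
    rw [← Matrix.exp_nsmul, ← Nat.cast_smul_eq_nsmul ℝ, smul_smul, mul_inv_cancel₀ (by positivity),
      one_smul]
  rw [hp, hp]

end GoldenThompson

section SpectralBounds

open scoped MatrixOrder Matrix.Norms.L2Operator

variable {n : Type*} [Fintype n] [DecidableEq n]

lemma trace_re_mono {n : Type*} [Fintype n] {A B : Matrix n n ℂ} (h : A ≤ B) :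
    A.trace.re ≤ B.trace.re := by
  have := (Complex.nonneg_iff.mp (Matrix.le_iff.mp h).trace_nonneg).1
  rw [Matrix.trace_sub, Complex.sub_re] at this
  linarith

lemma trace_mul_re_mono {A B C : Matrix n n ℂ} (hA : 0 ≤ A) (h : B ≤ C) :
    (A * B).trace.re ≤ (A * C).trace.re := by
  have := trace_mul_re_nonneg (Matrix.nonneg_iff_posSemidef.mp hA) (Matrix.le_iff.mp h)
  rw [mul_sub, Matrix.trace_sub, Complex.sub_re] at this
  linarith

lemma real_exp_le_one_add_add_sq {x : ℝ} (hx : x ≤ 1) : Real.exp x ≤ 1 + x + x ^ 2 := by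
  by_cases h : -1 ≤ x
  · have := (abs_le.mp (Real.abs_exp_sub_one_sub_id_le (abs_le.mpr ⟨h, hx⟩))).2
    linarith
  · have : Real.exp x ≤ 1 := Real.exp_le_one_iff.mpr (by linarith)
    nlinarith

lemma exp_le_one_add_add_sq {X : Matrix n n ℂ} (hX : X.IsHermitian) (h1 : X ≤ 1) :
    NormedSpace.exp X ≤ 1 + X + X ^ 2 := by
  have hX' : IsSelfAdjoint X := hX
  have hs := (CFC.le_one_iff (R := ℝ) X).mp h1
  have hr : cfc (fun x : ℝ => 1 + x + x ^ 2) X = 1 + X + X ^ 2 := by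
    rw [cfc_add X (fun x : ℝ => 1 + x) (fun x => x ^ 2), cfc_add X (fun _ : ℝ => 1) (fun x => x),
      cfc_const_one ℝ X, cfc_id' ℝ X, cfc_pow_id X 2]
  rw [← CFC.real_exp_eq_normedSpace_exp hX', ← hr]
  exact cfc_mono fun x hx => real_exp_le_one_add_add_sq (hs x hx)

lemma exp_le_one_of_nonpos {X : Matrix n n ℂ} (hX : X ≤ 0) : NormedSpace.exp X ≤ 1 := by
  have hX' : IsSelfAdjoint X := by simpa using (IsSelfAdjoint.of_nonneg (neg_nonneg.mpr hX)).neg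
  have hs : ∀ x ∈ spectrum ℝ X, x ≤ 0 := by
    refine (le_algebraMap_iff_spectrum_le (A := Matrix n n ℂ) (R := ℝ)).mp ?_
    simpa using hX
  rw [← CFC.real_exp_eq_normedSpace_exp hX', CFC.le_one_iff (R := ℝ) _]
  rw [cfc_map_spectrum Real.exp X]
  rintro _ ⟨x, hx, rfl⟩
  exact Real.exp_le_one_iff.mpr (hs x hx)

/-- Monotonicity of the trace exponential in the Loewner order. -/
lemma trace_exp_mono {A B : Matrix n n ℂ} (hA : A.IsHermitian) (hB : B.IsHermitian) (h : A ≤ B) :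
    (NormedSpace.exp A).trace.re ≤ (NormedSpace.exp B).trace.re := by
  have h1 := trace_exp_add_re_le hB (hA.sub hB)
  have h2 := trace_mul_re_mono (IsSelfAdjoint.exp_nonneg (a := B) hB)
    (exp_le_one_of_nonpos (sub_nonpos.mpr h))
  rw [add_sub_cancel] at h1
  rw [mul_one] at h2
  exact h1.trans h2

/-- Averaging small perturbations with nonpositive `E[X + X²]` does not increase the trace
exponential. -/
lemma sum_mul_trace_exp_add_le {ι : Type*} (s : Finset ι) (q : ι → ℝ) (hq0 : ∀ e ∈ s, 0 ≤ q e)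
    (hq1 : ∑ e ∈ s, q e = 1) {H : Matrix n n ℂ} (hH : H.IsHermitian) (X : ι → Matrix n n ℂ)
    (hX : ∀ e, (X e).IsHermitian) (hX1 : ∀ e ∈ s, q e ≠ 0 → X e ≤ 1)
    (hXX : ∑ e ∈ s, q e • (X e + X e ^ 2) ≤ 0) :
    ∑ e ∈ s, q e * (NormedSpace.exp (H + X e)).trace.re ≤ (NormedSpace.exp H).trace.re := by
  have hH0 := IsSelfAdjoint.exp_nonneg (a := H) hH
  have h1 : ∀ e ∈ s, q e * (NormedSpace.exp (H + X e)).trace.re ≤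
      (NormedSpace.exp H * (q e • (1 + X e + X e ^ 2))).trace.re := by
    intro e he
    rw [Matrix.mul_smul, Matrix.trace_smul, Complex.smul_re, smul_eq_mul]
    rcases eq_or_ne (q e) 0 with h0 | h0
    · simp [h0]
    · refine mul_le_mul_of_nonneg_left ?_ (hq0 e he)
      exact (trace_exp_add_re_le hH (hX e)).trans
        (trace_mul_re_mono hH0 (exp_le_one_add_add_sq (hX e) (hX1 e he h0)))
  refine (Finset.sum_le_sum h1).trans ?_
  rw [← Complex.re_sum, ← Matrix.trace_sum, ← Finset.mul_sum]
  have h2 : ∑ e ∈ s, q e • (1 + X e + X e ^ 2) = 1 + ∑ e ∈ s, q e • (X e + X e ^ 2) := by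
    simp only [add_assoc, smul_add (_ : ℝ) (1 : Matrix n n ℂ), Finset.sum_add_distrib,
      ← Finset.sum_smul, hq1, one_smul]
  have h3 := trace_mul_re_mono hH0 (show ∑ e ∈ s, q e • (1 + X e + X e ^ 2) ≤ 1 by
    rw [h2]; exact add_le_of_nonpos_right hXX)
  rwa [mul_one] at h3

lemma trace_cfc_re {A : Matrix n n ℂ} (hA : A.IsHermitian) (f : ℝ → ℝ) :
    (cfc f A).trace.re = ∑ i, f (hA.eigenvalues i) := by
  rw [hA.cfc_eq, Matrix.IsHermitian.cfc, Unitary.conjStarAlgAut_apply, Matrix.trace_mul_cycle,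
    Unitary.coe_star_mul_self, one_mul, Matrix.trace_diagonal, Complex.re_sum]
  simp

lemma trace_exp_add_trace_exp_neg {B : Matrix n n ℂ} (hB : B.IsHermitian) :
    ((NormedSpace.exp B).trace.re - Fintype.card n) +
      ((NormedSpace.exp (-B)).trace.re - Fintype.card n) =
    ∑ i, (Real.exp (hB.eigenvalues i) + Real.exp (-hB.eigenvalues i) - 2) := by
  have hB' : IsSelfAdjoint B := hB
  have h : NormedSpace.exp (-B) = cfc (fun y : ℝ => Real.exp (-y)) B := by
    rw [cfc_comp_neg Real.exp B, CFC.real_exp_eq_normedSpace_exp hB'.neg]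
  rw [h, ← CFC.real_exp_eq_normedSpace_exp hB', trace_cfc_re hB, trace_cfc_re hB]
  simp only [Finset.sum_sub_distrib, Finset.sum_add_distrib, Finset.sum_const, Finset.card_univ,
    nsmul_eq_mul]
  ring

lemma exp_add_exp_neg_sub_two_nonneg (y : ℝ) : 0 ≤ Real.exp y + Real.exp (-y) - 2 := by
  linarith [Real.add_one_le_exp y, Real.add_one_le_exp (-y)]

lemma trace_exp_two_sided_nonneg {B : Matrix n n ℂ} (hB : B.IsHermitian) :
    0 ≤ ((NormedSpace.exp B).trace.re - Fintype.card n) +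
      ((NormedSpace.exp (-B)).trace.re - Fintype.card n) := by
  rw [trace_exp_add_trace_exp_neg hB]
  exact Finset.sum_nonneg fun i _ => exp_add_exp_neg_sub_two_nonneg _

/-- Lower bound for the two-sided centred trace exponential in terms of the operator norm. -/
lemma exp_sub_sub_one_le_trace_exp {B : Matrix n n ℂ} (hB : B.IsHermitian) {x : ℝ} (hx : 0 < x)
    (hxB : x ≤ ‖B‖) :
    Real.exp x - x - 1 ≤ ((NormedSpace.exp B).trace.re - Fintype.card n) +
      ((NormedSpace.exp (-B)).trace.re - Fintype.card n) := by
  have hB' : IsSelfAdjoint B := hB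
  obtain ⟨i, hi⟩ : ∃ i, x ≤ |hB.eigenvalues i| := by
    by_contra! h
    have := norm_cfc_lt (𝕜 := ℝ) (f := fun y => y) (a := B) hx (fun y hy => by
      rw [hB.spectrum_real_eq_range_eigenvalues] at hy
      obtain ⟨i, rfl⟩ := hy
      exact h i)
    rw [cfc_id' ℝ B] at this
    linarith
  have hterm : Real.exp x - x - 1 ≤
      Real.exp (hB.eigenvalues i) + Real.exp (-hB.eigenvalues i) - 2 := by
    have hsymm : Real.exp |hB.eigenvalues i| + Real.exp (-|hB.eigenvalues i|) =
        Real.exp (hB.eigenvalues i) + Real.exp (-hB.eigenvalues i) := by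
      rcases abs_choice (hB.eigenvalues i) with h | h <;> rw [h]
      rw [neg_neg, add_comm]
    set y := |hB.eigenvalues i|
    have hmono : Real.exp x - x ≤ Real.exp y - y := by
      have h1 : Real.exp y = Real.exp x * Real.exp (y - x) := by rw [← Real.exp_add]; congr 1; ring
      have h2 := Real.add_one_le_exp (y - x)
      have h3 := Real.one_le_exp hx.le
      nlinarith
    linarith [Real.add_one_le_exp (-y)]
  rw [trace_exp_add_trace_exp_neg hB]
  exact hterm.trans (Finset.single_le_sum
    (f := fun j => Real.exp (hB.eigenvalues j) + Real.exp (-hB.eigenvalues j) - 2)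
    (fun j _ => exp_add_exp_neg_sub_two_nonneg _) (Finset.mem_univ i))

/-- Intrinsic dimension bound for the trace exponential of a positive semidefinite matrix. -/
lemma trace_exp_smul_sub_card_le {M : Matrix n n ℂ} (hM : 0 ≤ M) (hM0 : M ≠ 0) (a : ℝ) :
    (NormedSpace.exp (a • M)).trace.re - Fintype.card n ≤
      M.trace.re / ‖M‖ * (Real.exp (a * ‖M‖) - 1) := by
  have hM' : IsSelfAdjoint M := .of_nonneg hM
  have hκ : 0 < ‖M‖ := norm_pos_iff.mpr hM0
  set b := (Real.exp (a * ‖M‖) - 1) / ‖M‖ with hb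
  have hexp : NormedSpace.exp (a • M) = cfc (fun x : ℝ => Real.exp (a * x)) M := by
    have := cfc_comp_smul a Real.exp M
    simp only [smul_eq_mul] at this
    rw [this, CFC.real_exp_eq_normedSpace_exp (IsSelfAdjoint.smul (IsSelfAdjoint.all a) hM')]
  have hlin : cfc (fun x : ℝ => 1 + b * x) M = 1 + b • M := by
    rw [cfc_add M (fun _ : ℝ => 1) (fun x => b * x), cfc_const_one ℝ M, cfc_const_mul b _ M,
      cfc_id' ℝ M]
  have hle : NormedSpace.exp (a • M) ≤ 1 + b • M := by
    rw [hexp, ← hlin]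
    refine cfc_mono fun x hx => ?_
    have hx0 : 0 ≤ x := spectrum_nonneg_of_nonneg hM hx
    have hx1 : x ≤ ‖M‖ := by
      have := norm_apply_le_norm_cfc (𝕜 := ℝ) (fun y => y) M hx
      rw [cfc_id' ℝ M] at this
      exact (le_abs_self x).trans this
    have hcv := convexOn_exp.2 (Set.mem_univ 0) (Set.mem_univ (a * ‖M‖))
      (show 0 ≤ 1 - x / ‖M‖ by rw [sub_nonneg, div_le_one hκ]; exact hx1)
      (show 0 ≤ x / ‖M‖ by positivity) (by ring)
    simp only [smul_eq_mul, mul_zero, zero_add, Real.exp_zero, mul_one] at hcv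
    rw [show x / ‖M‖ * (a * ‖M‖) = a * x by field_simp] at hcv
    refine hcv.trans_eq ?_
    rw [hb]; field_simp; ring
  have := trace_re_mono hle
  rw [Matrix.trace_add, Matrix.trace_one, Matrix.trace_smul, Complex.add_re, Complex.smul_re,
    Complex.natCast_re, smul_eq_mul] at this
  rw [hb] at this
  calc _ ≤ (Real.exp (a * ‖M‖) - 1) / ‖M‖ * M.trace.re := by linarith
    _ = _ := by ring

end SpectralBounds

section MatrixVariance

open scoped MatrixOrder Matrix.Norms.L2Operator

variable {n : Type*} [Fintype n] [DecidableEq n] {ι : Type*} [Fintype ι]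

lemma sq_nonneg_of_isHermitian {A : Matrix n n ℂ} (hA : A.IsHermitian) : 0 ≤ A ^ 2 := by
  have h : IsSelfAdjoint A := hA
  rw [pow_two]
  exact h.mul_self_nonneg

lemma sq_le_smul {A : Matrix n n ℂ} {r : ℝ} (hA : 0 ≤ A) (hAr : A ≤ r • 1) : A ^ 2 ≤ r • A := by
  have hc : Commute A (r • 1 - A) :=
    ((Commute.one_right A).smul_right r).sub_right (Commute.refl A)
  have h := hc.mul_nonneg hA (sub_nonneg.mpr hAr)
  rw [mul_sub, mul_smul_comm, mul_one, ← pow_two, sub_nonneg] at h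
  exact h

lemma isHermitian_sum_smul {n : Type*} [Fintype n] {Y : ι → Matrix n n ℂ} (hY0 : ∀ i, 0 ≤ Y i)
    (a : ι → ℝ) :
    (∑ i, a i • Y i).IsHermitian := by
  refine isSelfAdjoint_sum _ fun i _ => ?_
  exact IsSelfAdjoint.smul (IsSelfAdjoint.all (a i)) (.of_nonneg (hY0 i))

lemma sum_smul_le_smul_one {Y : ι → Matrix n n ℂ} {r d : ℝ} (hr : 0 ≤ r) (hY0 : ∀ i, 0 ≤ Y i)
    (hYr : ∀ i, Y i ≤ r • 1) {a : ι → ℝ} (ha : ∑ i, |a i| ≤ d) :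
    ∑ i, a i • Y i ≤ (r * d) • 1 := by
  calc ∑ i, a i • Y i ≤ ∑ i, |a i| • (r • (1 : Matrix n n ℂ)) := by
        refine Finset.sum_le_sum fun i _ => ?_
        exact (smul_le_smul_of_nonneg_right (le_abs_self _) (hY0 i)).trans
          (smul_le_smul_of_nonneg_left (hYr i) (abs_nonneg _))
    _ = (r * ∑ i, |a i|) • 1 := by rw [← Finset.sum_smul, smul_smul, mul_comm]
    _ ≤ (r * d) • 1 := smul_le_smul_of_nonneg_right (by gcongr) zero_le_one

lemma sum_smul_sq_le {Y : ι → Matrix n n ℂ} {r d : ℝ} (hY0 : ∀ i, 0 ≤ Y i)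
    (hYr : ∀ i, Y i ≤ r • 1) {a : ι → ℝ} (ha : ∑ i, |a i| ≤ d) :
    (∑ i, a i • Y i) ^ 2 ≤ (d * r) • ∑ i, |a i| • Y i := by
  have hd : 0 ≤ d := (Finset.sum_nonneg fun i _ => abs_nonneg (a i)).trans ha
  set D := ∑ i, a i • Y i with hD
  have hDh : D.IsHermitian := isHermitian_sum_smul hY0 a
  rcases hd.eq_or_lt with h0 | h0
  · have hz : ∀ i, a i = 0 := fun i => by
      have := Finset.single_le_sum (f := fun i => |a i|) (fun i _ => abs_nonneg _)
        (Finset.mem_univ i)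
      exact abs_nonpos_iff.mp (by linarith)
    simp [hD, hz]
  have hsign (i : ι) : |a i| * (SignType.sign (a i) : ℝ) = a i := by
    rw [mul_comm]; exact sign_mul_abs (a i)
  have hsq (i : ι) : |a i| * (SignType.sign (a i) : ℝ) ^ 2 = |a i| := by
    rw [pow_two, ← mul_assoc, hsign, mul_comm]; exact sign_mul_self (a i)
  have hterm (i : ι) : |a i| • ((d * (SignType.sign (a i) : ℝ)) • Y i - D) ^ 2 =
      (d ^ 2) • (|a i| • Y i ^ 2) - d • ((a i • Y i) * D + D * (a i • Y i)) + |a i| • D ^ 2 := by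
    have : ((d * (SignType.sign (a i) : ℝ)) • Y i - D) ^ 2 =
        (d ^ 2 * (SignType.sign (a i) : ℝ) ^ 2) • Y i ^ 2
          - (d * (SignType.sign (a i) : ℝ)) • (Y i * D + D * Y i) + D ^ 2 := by
      simp only [pow_two, sub_mul, mul_sub, smul_mul_assoc, mul_smul_comm]
      module
    rw [this, smul_add, smul_sub, smul_smul, smul_smul, smul_smul, smul_mul_assoc, mul_smul_comm,
      ← smul_add, smul_smul,
      show |a i| * (d ^ 2 * (SignType.sign (a i) : ℝ) ^ 2) =
        d ^ 2 * (|a i| * (SignType.sign (a i) : ℝ) ^ 2) by ring, hsq,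
      show |a i| * (d * (SignType.sign (a i) : ℝ)) =
        d * (|a i| * (SignType.sign (a i) : ℝ)) by ring, hsign]
  have hpos : 0 ≤ ∑ i, |a i| • ((d * (SignType.sign (a i) : ℝ)) • Y i - D) ^ 2 :=
    Finset.sum_nonneg fun i _ => smul_nonneg (abs_nonneg _) (sq_nonneg_of_isHermitian
      (Matrix.IsHermitian.sub (IsSelfAdjoint.smul (IsSelfAdjoint.all _) (.of_nonneg (hY0 i))) hDh))
  simp only [hterm, Finset.sum_add_distrib, Finset.sum_sub_distrib, ← Finset.smul_sum,
    ← Finset.sum_mul, ← Finset.mul_sum, ← Finset.sum_smul, ← hD] at hpos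
  have hD2 := sq_nonneg_of_isHermitian hDh
  have h1 : d • D ^ 2 ≤ (d ^ 2) • ∑ i, |a i| • Y i ^ 2 := by
    have h2 : (∑ i, |a i|) • D ^ 2 ≤ d • D ^ 2 := smul_le_smul_of_nonneg_right ha hD2
    have h3 := hpos.trans (add_le_add_right h2 _)
    rw [← sub_nonneg]
    convert h3 using 1
    rw [← pow_two, smul_add]
    abel
  have h2 : ∑ i, |a i| • Y i ^ 2 ≤ r • ∑ i, |a i| • Y i := by
    rw [Finset.smul_sum]
    refine Finset.sum_le_sum fun i _ => ?_
    rw [smul_comm]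
    exact smul_le_smul_of_nonneg_left (sq_le_smul (hY0 i) (hYr i)) (abs_nonneg _)
  have h3 := smul_le_smul_of_nonneg_left
    (h1.trans (smul_le_smul_of_nonneg_left h2 (sq_nonneg d))) (inv_nonneg.mpr hd)
  rw [smul_smul, inv_mul_cancel₀ h0.ne', one_smul, smul_smul, smul_smul,
    show d⁻¹ * d ^ 2 * r = d * r by field_simp] at h3
  exact h3

/-- First-plus-second moment bound for the increments `η D_e - c θ² Y_e`. -/
lemma sum_smul_add_sq_nonpos [DecidableEq ι] {Y : ι → Matrix n n ℂ} {r d c θ : ℝ} (hr : 0 ≤ r)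
    (hd : 0 ≤ d) (hY0 : ∀ i, 0 ≤ Y i) (hYr : ∀ i, Y i ≤ r • 1) (hc0 : 0 ≤ c)
    (hc : r / 2 * (9 * d ^ 2 + 1) ≤ c) (hθ : c * |θ| ≤ 1 / 2)
    (s : Finset ι) {w : ι → ℝ} (hw : ∀ e ∈ s, 0 ≤ w e) (δ : ι → ι → ℝ)
    (hδ : ∀ e ∈ s, w e ≠ 0 → ∑ i, |δ e i| ≤ d)
    (hδ0 : ∀ i, ∑ e ∈ s, w e * δ e i = 0)
    (hδs : ∀ i, ∑ e ∈ s, w e * |δ e i| ≤ d * (if i ∈ s then w i else 0)) :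
    ∑ e ∈ s, w e • (((θ + c * θ ^ 2) • ∑ i, δ e i • Y i - (c * θ ^ 2) • Y e) +
      ((θ + c * θ ^ 2) • ∑ i, δ e i • Y i - (c * θ ^ 2) • Y e) ^ 2) ≤ 0 := by
  set η := θ + c * θ ^ 2 with hη
  set D : ι → Matrix n n ℂ := fun e => ∑ i, δ e i • Y i with hD
  set Q : Matrix n n ℂ := ∑ e ∈ s, w e • Y e with hQ
  have hQ0 : 0 ≤ Q := Finset.sum_nonneg fun e he => smul_nonneg (hw e he) (hY0 e)
  have hDh (e) : (D e).IsHermitian := isHermitian_sum_smul hY0 _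
  have hDsum : ∑ e ∈ s, w e • D e = 0 := by
    simp only [hD, Finset.smul_sum, smul_smul]
    rw [Finset.sum_comm]
    simp only [← Finset.sum_smul, hδ0, zero_smul, Finset.sum_const_zero]
  have hDsq : ∑ e ∈ s, w e • D e ^ 2 ≤ (d ^ 2 * r) • Q := by
    have h1 : ∑ e ∈ s, w e • D e ^ 2 ≤ ∑ e ∈ s, w e • ((d * r) • ∑ i, |δ e i| • Y i) := by
      refine Finset.sum_le_sum fun e he => ?_
      rcases eq_or_ne (w e) 0 with h0 | h0
      · simp [h0]
      · exact smul_le_smul_of_nonneg_left (sum_smul_sq_le hY0 hYr (hδ e he h0)) (hw e he)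
    have h2 : ∑ e ∈ s, w e • ((d * r) • ∑ i, |δ e i| • Y i) =
        (d * r) • ∑ i, (∑ e ∈ s, w e * |δ e i|) • Y i := by
      simp only [Finset.sum_smul, Finset.smul_sum, smul_smul]
      rw [Finset.sum_comm]
      refine Finset.sum_congr rfl fun i _ => Finset.sum_congr rfl fun e _ => ?_
      congr 1; ring
    have h3 : ∑ i, (∑ e ∈ s, w e * |δ e i|) • Y i ≤ d • Q := by
      refine (Finset.sum_le_sum fun i _ => smul_le_smul_of_nonneg_right (hδs i) (hY0 i)).trans_eq ?_
      simp [hQ, Finset.smul_sum, smul_smul, ite_smul, mul_ite]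
    refine h1.trans (h2.trans_le ?_)
    refine (smul_le_smul_of_nonneg_left h3 (by positivity)).trans_eq ?_
    rw [smul_smul]; congr 1; ring
  have hYsq : ∑ e ∈ s, w e • Y e ^ 2 ≤ r • Q := by
    rw [hQ, Finset.smul_sum]
    refine Finset.sum_le_sum fun e he => ?_
    rw [smul_comm]
    exact smul_le_smul_of_nonneg_left (sq_le_smul (hY0 e) (hYr e)) (hw e he)
  have hXsq (e) : (η • D e - (c * θ ^ 2) • Y e) ^ 2 ≤
      (2 * η ^ 2) • D e ^ 2 + (2 * (c * θ ^ 2) ^ 2) • Y e ^ 2 := by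
    have hh : (η • D e + (c * θ ^ 2) • Y e).IsHermitian :=
      Matrix.IsHermitian.add (IsSelfAdjoint.smul (IsSelfAdjoint.all _) (hDh e))
        (IsSelfAdjoint.smul (IsSelfAdjoint.all _) (.of_nonneg (hY0 e)))
    have h := sq_nonneg_of_isHermitian hh
    rw [← sub_nonneg]
    convert h using 1
    simp only [pow_two, sub_mul, mul_sub, add_mul, mul_add, smul_mul_assoc, mul_smul_comm]
    module
  have hη2 : η ^ 2 ≤ 9 / 4 * θ ^ 2 := by
    have h1 : |c * θ| ≤ 1 / 2 := by rwa [abs_mul, abs_of_nonneg hc0]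
    obtain ⟨h2, h3⟩ := abs_le.mp h1
    have : (1 + c * θ) ^ 2 ≤ 9 / 4 := by nlinarith
    rw [hη, show (θ + c * θ ^ 2) ^ 2 = (1 + c * θ) ^ 2 * θ ^ 2 by ring]
    gcongr
  have hcθ : (c * θ ^ 2) ^ 2 ≤ 1 / 4 * θ ^ 2 := by
    have h1 : (c * |θ|) ^ 2 ≤ (1 / 2) ^ 2 := by gcongr
    rw [mul_pow, sq_abs] at h1
    nlinarith [sq_nonneg θ]
  have hcoef : 2 * η ^ 2 * (d ^ 2 * r) + 2 * (c * θ ^ 2) ^ 2 * r ≤ c * θ ^ 2 := by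
    have h1 : η ^ 2 * (d ^ 2 * r) ≤ 9 / 4 * θ ^ 2 * (d ^ 2 * r) := by gcongr
    have h2 : (c * θ ^ 2) ^ 2 * r ≤ 1 / 4 * θ ^ 2 * r := by gcongr
    have h3 := mul_le_mul_of_nonneg_right hc (sq_nonneg θ)
    nlinarith
  calc ∑ e ∈ s, w e • ((η • D e - (c * θ ^ 2) • Y e) + (η • D e - (c * θ ^ 2) • Y e) ^ 2)
      ≤ ∑ e ∈ s, w e • ((η • D e - (c * θ ^ 2) • Y e) +
          ((2 * η ^ 2) • D e ^ 2 + (2 * (c * θ ^ 2) ^ 2) • Y e ^ 2)) :=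
        Finset.sum_le_sum fun e he =>
          smul_le_smul_of_nonneg_left (add_le_add_right (hXsq e) _) (hw e he)
    _ = η • ∑ e ∈ s, w e • D e - (c * θ ^ 2) • Q + ((2 * η ^ 2) • ∑ e ∈ s, w e • D e ^ 2 +
          (2 * (c * θ ^ 2) ^ 2) • ∑ e ∈ s, w e • Y e ^ 2) := by
        simp only [hQ, Finset.smul_sum, ← Finset.sum_add_distrib, ← Finset.sum_sub_distrib]
        refine Finset.sum_congr rfl fun e _ => ?_
        simp only [smul_add, smul_sub, smul_comm (w e)]
    _ ≤ η • 0 - (c * θ ^ 2) • Q + ((2 * η ^ 2) • ((d ^ 2 * r) • Q) +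
          (2 * (c * θ ^ 2) ^ 2) • (r • Q)) := by
        rw [hDsum]
        exact add_le_add_right (add_le_add (smul_le_smul_of_nonneg_left hDsq (by positivity))
          (smul_le_smul_of_nonneg_left hYsq (by positivity))) _
    _ = (2 * η ^ 2 * (d ^ 2 * r) + 2 * (c * θ ^ 2) ^ 2 * r - c * θ ^ 2) • Q := by
        rw [smul_zero, sub_smul, add_smul, smul_smul, smul_smul]; abel
    _ ≤ 0 := smul_nonpos_of_nonpos_of_nonneg (by linarith) hQ0

end MatrixVariance

section PointProcess

variable {α : Type*} [Fintype α] [DecidableEq α]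

/-- The probability `Pr(A ⊆ X)` that a point process contains the set `A`. -/
noncomputable def supersetMass (μ : Finset α → ℝ) (A : Finset α) : ℝ :=
  ∑ F with A ⊆ F, μ F

/-- The conditional probability `Pr(i ∈ X | A ⊆ X)`. -/
noncomputable def condIntensity (μ : Finset α → ℝ) (A : Finset α) (i : α) : ℝ :=
  supersetMass μ (insert i A) / supersetMass μ A

lemma supersetMass_nonneg {μ : Finset α → ℝ} (hμ0 : ∀ F, 0 ≤ μ F) (A : Finset α) :
    0 ≤ supersetMass μ A :=
  Finset.sum_nonneg fun F _ => hμ0 F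

lemma supersetMass_anti {μ : Finset α → ℝ} (hμ0 : ∀ F, 0 ≤ μ F) {A B : Finset α} (h : A ⊆ B) :
    supersetMass μ B ≤ supersetMass μ A := by
  refine Finset.sum_le_sum_of_subset_of_nonneg ?_ fun F _ _ => hμ0 F
  intro F hF
  simp only [Finset.mem_filter, Finset.mem_univ, true_and] at hF ⊢
  exact h.trans hF

lemma supersetMass_eq_zero_of_subset {μ : Finset α → ℝ} (hμ0 : ∀ F, 0 ≤ μ F) {A B : Finset α}
    (h : A ⊆ B) (hA : supersetMass μ A = 0) : supersetMass μ B = 0 :=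
  le_antisymm ((supersetMass_anti hμ0 h).trans_eq hA) (supersetMass_nonneg hμ0 B)

lemma redNorm_empty_left (μ : Finset α → ℝ) (A : Finset α) :
    redNorm μ ∅ A = supersetMass μ A := by
  unfold redNorm supersetMass
  refine Finset.sum_nbij' (fun B => A ∪ B) (fun F => F \ A) ?_ ?_ ?_ ?_ ?_
  · intro B _; simp
  · intro F _; simpa using Finset.sdiff_disjoint
  · intro B hB
    simp only [Finset.empty_union, Finset.mem_filter, Finset.mem_univ, true_and] at hB
    rw [Finset.union_sdiff_left, Finset.sdiff_eq_self_of_disjoint hB]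
  · intro F hF
    simp only [Finset.mem_filter, Finset.mem_univ, true_and] at hF
    exact Finset.union_sdiff_of_subset hF
  · intro B _; rfl

lemma intensity_eq_supersetMass (μ : Finset α → ℝ) (i : α) :
    intensity μ i = supersetMass μ {i} := by
  simp [intensity, supersetMass]

lemma supersetMass_reduced (μ : Finset α → ℝ) {A B : Finset α} (h : Disjoint B A) :
    supersetMass (reduced μ ∅ A) B = supersetMass μ (A ∪ B) / supersetMass μ A := by
  unfold supersetMass reduced
  rw [redNorm_empty_left, Finset.sum_div, ← Finset.sum_filter, Finset.filter_filter]
  refine Finset.sum_nbij' (fun C => A ∪ C) (fun F => F \ A) ?_ ?_ ?_ ?_ ?_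
  · intro C hC
    simp only [Finset.mem_filter, Finset.mem_univ, true_and] at hC ⊢
    exact Finset.union_subset_union_right hC.1
  · intro F hF
    simp only [Finset.mem_filter, Finset.mem_univ, true_and, Finset.empty_union] at hF ⊢
    exact ⟨Finset.subset_sdiff.mpr ⟨Finset.subset_union_right.trans hF, h⟩, Finset.sdiff_disjoint⟩
  · intro C hC
    simp only [Finset.empty_union, Finset.mem_filter, Finset.mem_univ, true_and] at hC
    rw [Finset.union_sdiff_left, Finset.sdiff_eq_self_of_disjoint hC.2]
  · intro F hF
    simp only [Finset.mem_filter, Finset.mem_univ, true_and] at hF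
    exact Finset.union_sdiff_of_subset (Finset.subset_union_left.trans hF)
  · intro C _; rfl

lemma intensity_reduced_of_notMem (μ : Finset α → ℝ) {A : Finset α} {i : α} (hi : i ∉ A) :
    intensity (reduced μ ∅ A) i = condIntensity μ A i := by
  rw [intensity_eq_supersetMass, supersetMass_reduced μ (Finset.disjoint_singleton_left.mpr hi),
    condIntensity, Finset.union_comm, ← Finset.insert_eq]

lemma intensity_reduced_of_mem (μ : Finset α → ℝ) {A : Finset α} {i : α} (hi : i ∈ A) :
    intensity (reduced μ ∅ A) i = 0 := by
  refine Finset.sum_eq_zero fun F hF => ?_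
  have hF' : i ∈ F := by simpa using hF
  rw [reduced, if_neg]
  rw [Finset.empty_union]
  exact fun h => Finset.disjoint_left.mp h hF' hi

lemma condIntensity_of_mem {μ : Finset α → ℝ} {A : Finset α} (hA : supersetMass μ A ≠ 0) {i : α}
    (hi : i ∈ A) : condIntensity μ A i = 1 := by
  rw [condIntensity, Finset.insert_eq_of_mem hi, div_self hA]

/-- `ℓ∞`-independence in terms of conditional intensities. -/
lemma LinftyIndep.sum_abs_condIntensity_sub_le {μ : Finset α → ℝ} (hμ0 : ∀ F, 0 ≤ μ F) {d : ℝ}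
    (hind : LinftyIndep μ d) {A : Finset α} (hA : supersetMass μ A ≠ 0) {e : α} (he : e ∉ A)
    (heA : supersetMass μ (insert e A) ≠ 0) :
    ∑ i, |condIntensity μ (insert e A) i - condIntensity μ A i| ≤ d := by
  have h := hind ∅ A (Finset.disjoint_empty_left A) (by rwa [redNorm_empty_left]) e (by
    rw [intensity_reduced_of_notMem μ he]; exact div_ne_zero heA hA)
  rw [Finset.sum_filter] at h
  refine le_trans (Finset.sum_le_sum fun i _ => le_of_eq ?_) h
  by_cases hi : i ∈ A
  · rw [if_neg (by rw [intensity_reduced_of_mem μ hi]; simp), condIntensity_of_mem hA hi,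
      condIntensity_of_mem heA (Finset.mem_insert_of_mem hi), sub_self, abs_zero]
  rw [intensity_reduced_of_notMem μ hi]
  by_cases h0 : supersetMass μ (insert i A) = 0
  · have h1 : supersetMass μ (insert i (insert e A)) = 0 :=
      supersetMass_eq_zero_of_subset hμ0 (Finset.insert_subset_insert i (Finset.subset_insert e A))
        h0
    simp [condIntensity, h0, h1]
  rw [if_pos (show condIntensity μ A i ≠ 0 from div_ne_zero h0 hA), deltaPP]
  split_ifs with hie
  · subst hie
    rw [intensity_reduced_of_notMem μ hi, condIntensity_of_mem heA (Finset.mem_insert_self i A)]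
  · have hdisj : Disjoint ({e} ∪ {i} : Finset α) A := by
      rw [Finset.disjoint_union_left]
      exact ⟨Finset.disjoint_singleton_left.mpr he, Finset.disjoint_singleton_left.mpr hi⟩
    have h2 : intensity (reduced (reduced μ ∅ A) ∅ {e}) i = condIntensity μ (insert e A) i := by
      rw [intensity_eq_supersetMass,
        supersetMass_reduced _ (Finset.disjoint_singleton.mpr hie), supersetMass_reduced μ hdisj,
        supersetMass_reduced μ (Finset.disjoint_singleton_left.mpr he), div_div_div_cancel_right₀ hA,
        condIntensity]
      congr 2
      · ext x; simp; tauto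
      · ext x; simp
    rw [h2, intensity_reduced_of_notMem μ hi]

/-- Double counting the elements of a homogeneous process outside a fixed subset. -/
lemma IsHomogeneous.sum_compl_sum_superset {μ : Finset α → ℝ} {k : ℕ} (hhom : IsHomogeneous μ k)
    {A : Finset α} {j : ℕ} (hj : A.card + j = k) (f : Finset α → ℝ) :
    ∑ e ∈ Aᶜ, ∑ F with insert e A ⊆ F, μ F * f F = j * ∑ F with A ⊆ F, μ F * f F := by
  simp only [Finset.sum_filter, Finset.mul_sum]
  rw [Finset.sum_comm]
  refine Finset.sum_congr rfl fun F _ => ?_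
  rcases eq_or_ne (μ F) 0 with h0 | h0
  · simp [h0]
  split_ifs with hAF
  · have hcard : (Aᶜ.filter fun e => insert e A ⊆ F).card = j := by
      have : (Aᶜ.filter fun e => insert e A ⊆ F) = F \ A := by
        ext e
        simp only [Finset.mem_filter, Finset.mem_compl, Finset.insert_subset_iff, Finset.mem_sdiff]
        tauto
      rw [this, Finset.card_sdiff_of_subset hAF, hhom F h0]
      omega
    rw [← Finset.sum_filter, Finset.sum_const, hcard, nsmul_eq_mul]
  · rw [mul_zero]
    refine Finset.sum_eq_zero fun e _ => if_neg fun h => hAF ((Finset.subset_insert e A).trans h)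

lemma IsHomogeneous.sum_compl_supersetMass {μ : Finset α → ℝ} {k : ℕ} (hhom : IsHomogeneous μ k)
    {A : Finset α} {j : ℕ} (hj : A.card + j = k) :
    ∑ e ∈ Aᶜ, supersetMass μ (insert e A) = j * supersetMass μ A := by
  simpa [supersetMass] using hhom.sum_compl_sum_superset hj fun _ => 1

lemma IsHomogeneous.sum_compl_supersetMass_insert {μ : Finset α → ℝ} {k : ℕ}
    (hhom : IsHomogeneous μ k) {A : Finset α} {j : ℕ} (hj : A.card + j = k) (i : α) :
    ∑ e ∈ Aᶜ, supersetMass μ (insert i (insert e A)) = j * supersetMass μ (insert i A) := by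
  have key (B : Finset α) : supersetMass μ (insert i B) =
      ∑ F with B ⊆ F, μ F * (if i ∈ F then 1 else 0) := by
    simp only [supersetMass, Finset.sum_filter, mul_ite, mul_one, mul_zero,
      Finset.insert_subset_iff]
    refine Finset.sum_congr rfl fun F _ => ?_
    by_cases h1 : i ∈ F <;> by_cases h2 : B ⊆ F <;> simp [h1, h2]
  simp only [key]
  exact hhom.sum_compl_sum_superset hj _

end PointProcess

section MomentGeneratingFunction

open scoped MatrixOrder Matrix.Norms.L2Operator

variable {α : Type*} [Fintype α] [DecidableEq α] {n : Type*} [Fintype n] [DecidableEq n]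

/-- Trace exponential moment bound for a homogeneous `ℓ∞`-independent process conditioned on
containing a given set, by revealing its remaining elements one at a time. -/
lemma sum_superset_trace_exp_le {μ : Finset α → ℝ} (hμ0 : ∀ F, 0 ≤ μ F) {k : ℕ}
    (hhom : IsHomogeneous μ k) {d : ℝ} (hind : LinftyIndep μ d) {Y : α → Matrix n n ℂ} {r c θ : ℝ}
    (hr : 0 < r) (hY0 : ∀ i, 0 ≤ Y i) (hYr : ∀ i, Y i ≤ r • 1) (hc1 : r * d ≤ c)
    (hc2 : r / 2 * (9 * d ^ 2 + 1) ≤ c) (hθ : c * |θ| ≤ 1 / 2) (j : ℕ) :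
    ∀ (A : Finset α), A.card + j = k → ∀ H : Matrix n n ℂ, H.IsHermitian →
      ∑ F with A ⊆ F, μ F * (NormedSpace.exp (H + θ • (∑ i ∈ F, Y i - ∑ i ∈ A, Y i))).trace.re ≤
        supersetMass μ A * (NormedSpace.exp (H + (θ + c * θ ^ 2) •
          (∑ i, condIntensity μ A i • Y i - ∑ i ∈ A, Y i))).trace.re := by
  have hc0 : 0 ≤ c := le_trans (by positivity) hc2
  have hherm {Z : Matrix n n ℂ} (a : ℝ) (hZ : Z.IsHermitian) : (a • Z).IsHermitian :=
    IsSelfAdjoint.smul (IsSelfAdjoint.all a) hZ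
  have hYh (i) : (Y i).IsHermitian := IsSelfAdjoint.of_nonneg (hY0 i)
  have hSh (A : Finset α) : (∑ i ∈ A, Y i).IsHermitian := isSelfAdjoint_sum _ fun i _ => hYh i
  induction j with
  | zero =>
    intro A hA H _
    have honly : ∀ F, A ⊆ F → μ F ≠ 0 → F = A := fun F hAF hF =>
      (Finset.eq_of_subset_of_card_le hAF (by rw [hhom F hF]; omega)).symm
    have hsingle (f : Finset α → ℝ) : ∑ F with A ⊆ F, μ F * f F = μ A * f A := by
      refine Finset.sum_eq_single A (fun F hF hne => ?_) (fun h => absurd (by simp) h)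
      rw [show μ F = 0 from by_contra fun h => hne (honly F (by simpa using hF) h), zero_mul]
    have hmass : supersetMass μ A = μ A := by simpa [supersetMass] using hsingle fun _ => 1
    rw [hsingle, hmass, sub_self, smul_zero]
    rcases eq_or_ne (μ A) 0 with h0 | h0
    · simp [h0]
    have hE : ∑ i, condIntensity μ A i • Y i = ∑ i ∈ A, Y i := by
      rw [← Finset.sum_subset (Finset.subset_univ A)]
      · exact Finset.sum_congr rfl fun i hi => by
          rw [condIntensity_of_mem (by rwa [hmass]) hi, one_smul]
      · intro i _ hi
        have : supersetMass μ (insert i A) = 0 := Finset.sum_eq_zero fun F hF => by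
          by_contra hne
          have hF' : insert i A ⊆ F := by simpa using hF
          have := honly F ((Finset.subset_insert i A).trans hF') hne
          exact hi (this ▸ hF' (Finset.mem_insert_self i A))
        rw [condIntensity, this, zero_div, zero_smul]
    rw [hE, sub_self, smul_zero]
  | succ j ih =>
    intro A hA H hH
    set W := supersetMass μ with hW
    rcases (supersetMass_nonneg hμ0 A).eq_or_lt with h0 | hWA
    · rw [hW, ← h0, zero_mul]
      refine le_of_eq (Finset.sum_eq_zero fun F hF => ?_)
      rw [(Finset.sum_eq_zero_iff_of_nonneg fun F _ => hμ0 F).mp h0.symm F hF, zero_mul]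
    have hWA' : W A ≠ 0 := hWA.ne'
    have hJ : (0 : ℝ) < (j + 1 : ℕ) := by positivity
    have hsumW : ∑ e ∈ Aᶜ, W (insert e A) = (j + 1 : ℕ) * W A := hhom.sum_compl_supersetMass hA
    have hT : 0 < (j + 1 : ℕ) * W A := mul_pos hJ hWA
    have hWn (B) : 0 ≤ W B := supersetMass_nonneg hμ0 B
    set δ : α → α → ℝ := fun e i => condIntensity μ (insert e A) i - condIntensity μ A i with hδdef
    have hδ : ∀ e ∈ Aᶜ, W (insert e A) ≠ 0 → ∑ i, |δ e i| ≤ d := fun e he hne =>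
      hind.sum_abs_condIntensity_sub_le hμ0 hWA.ne' (Finset.mem_compl.mp he) hne
    have hd : 0 ≤ d := by
      obtain ⟨e, he, hne⟩ := Finset.exists_ne_zero_of_sum_ne_zero (hsumW ▸ hT.ne')
      exact (Finset.sum_nonneg fun i _ => abs_nonneg _).trans (hδ e he hne)
    have hWδ (e i) : W (insert e A) * δ e i =
        W (insert i (insert e A)) - W (insert e A) * W (insert i A) / W A := by
      rcases eq_or_ne (W (insert e A)) 0 with h0 | h0
      · rw [h0, hW, supersetMass_eq_zero_of_subset hμ0 (Finset.subset_insert i _) h0]; simp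
      · simp only [hδdef, condIntensity, ← hW]
        field_simp
    have hsymm (e i) : W (insert e A) * |δ e i| = W (insert i A) * |δ i e| := by
      rw [← abs_of_nonneg (hWn (insert e A)), ← abs_of_nonneg (hWn (insert i A)), ← abs_mul,
        ← abs_mul, hWδ, hWδ, Finset.insert_comm, mul_comm (W (insert e A))]
    have hδ0 : ∀ i, ∑ e ∈ Aᶜ, W (insert e A) * δ e i = 0 := fun i => by
      simp only [hWδ, Finset.sum_sub_distrib, ← Finset.sum_div, ← Finset.sum_mul]
      rw [hsumW, hW, hhom.sum_compl_supersetMass_insert hA i, ← hW]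
      field_simp
      ring
    have hδs : ∀ i, ∑ e ∈ Aᶜ, W (insert e A) * |δ e i| ≤
        d * (if i ∈ Aᶜ then W (insert i A) else 0) := fun i => by
      split_ifs with hi
      · simp only [hsymm _ i, ← Finset.mul_sum]
        rcases eq_or_ne (W (insert i A)) 0 with h0 | h0
        · simp [h0]
        · rw [mul_comm d]
          refine mul_le_mul_of_nonneg_left (le_trans ?_ (hδ i hi h0)) (hWn _)
          exact Finset.sum_le_sum_of_subset_of_nonneg (Finset.subset_univ _)
            fun _ _ _ => abs_nonneg _
      · rw [mul_zero]
        refine le_of_eq (Finset.sum_eq_zero fun e _ => ?_)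
        rcases eq_or_ne (W (insert e A)) 0 with h0 | h0
        · simp [h0]
        · have hi' : i ∈ A := by simpa using hi
          simp [hδdef, condIntensity_of_mem hWA.ne' hi',
            condIntensity_of_mem h0 (Finset.mem_insert_of_mem hi')]
    set η := θ + c * θ ^ 2 with hη
    set D : α → Matrix n n ℂ := fun e => ∑ i, δ e i • Y i with hD
    have hDh (e) : (D e).IsHermitian := isHermitian_sum_smul hY0 _
    set X : α → Matrix n n ℂ := fun e => η • D e - (c * θ ^ 2) • Y e with hX
    set H' := H + η • (∑ i, condIntensity μ A i • Y i - ∑ i ∈ A, Y i) with hH'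
    have hH'h : H'.IsHermitian :=
      hH.add (hherm _ ((isHermitian_sum_smul hY0 _).sub (hSh A)))
    have hX1 : ∀ e ∈ Aᶜ, W (insert e A) ≠ 0 → X e ≤ 1 := by
      intro e he hne
      have hη1 : |η| * (r * d) ≤ 1 := by
        have h1 : |η| ≤ |θ| * (3 / 2) := by
          rw [hη, show θ + c * θ ^ 2 = θ * (1 + c * θ) by ring, abs_mul]
          gcongr
          refine (abs_add_le _ _).trans ?_
          rw [abs_one, abs_mul, abs_of_nonneg hc0]
          linarith
        have h2 : |η| * (r * d) ≤ |θ| * (3 / 2) * c := by gcongr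
        nlinarith
      have hDle : η • D e ≤ 1 := by
        have h1 : η • D e = ∑ i, (η * δ e i) • Y i := by
          simp only [hD, Finset.smul_sum, smul_smul]
        have h2 : ∑ i, |η * δ e i| ≤ |η| * d := by
          simp only [abs_mul, ← Finset.mul_sum]
          exact mul_le_mul_of_nonneg_left (hδ e he hne) (abs_nonneg _)
        rw [h1]
        refine (sum_smul_le_smul_one hr.le hY0 hYr h2).trans ?_
        refine (smul_le_smul_of_nonneg_right (?_ : r * (|η| * d) ≤ 1) zero_le_one).trans_eq
          (one_smul ℝ _)
        linarith
      exact (sub_le_self _ (smul_nonneg (by positivity) (hY0 e))).trans hDle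
    have hXX := sum_smul_add_sq_nonpos hr.le hd hY0 hYr hc0 hc2 hθ Aᶜ (w := fun e => W (insert e A))
      (fun e _ => hWn _) δ hδ hδ0 hδs
    have hstep := sum_mul_trace_exp_add_le Aᶜ (fun e => W (insert e A) / ((j + 1 : ℕ) * W A))
      (fun e _ => div_nonneg (hWn _) hT.le) (by rw [← Finset.sum_div, hsumW, div_self hT.ne'])
      hH'h X (fun e => (hherm _ (hDh e)).sub (hherm _ (hYh e)))
      (fun e he hne => hX1 e he fun h => hne (by rw [h, zero_div])) (by
        have := smul_nonpos_of_nonneg_of_nonpos (inv_nonneg.mpr hT.le) hXX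
        rw [Finset.smul_sum] at this
        simpa only [smul_smul, ← div_eq_inv_mul] using this)
    have hIH : ∀ e ∈ Aᶜ, ∑ F with insert e A ⊆ F,
        μ F * (NormedSpace.exp (H + θ • (∑ i ∈ F, Y i - ∑ i ∈ A, Y i))).trace.re ≤
          W (insert e A) * (NormedSpace.exp (H' + X e)).trace.re := by
      intro e he
      have heA := Finset.mem_compl.mp he
      have h := ih (insert e A) (by rw [Finset.card_insert_of_notMem heA]; omega) (H + θ • Y e)
        (hH.add (hherm _ (hYh e)))
      have h1 (F : Finset α) : H + θ • Y e + θ • (∑ i ∈ F, Y i - ∑ i ∈ insert e A, Y i) =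
          H + θ • (∑ i ∈ F, Y i - ∑ i ∈ A, Y i) := by
        rw [Finset.sum_insert heA]; module
      have h2 : H + θ • Y e + η • (∑ i, condIntensity μ (insert e A) i • Y i -
          ∑ i ∈ insert e A, Y i) = H' + X e := by
        have h3 : ∑ i, condIntensity μ (insert e A) i • Y i =
            ∑ i, condIntensity μ A i • Y i + D e := by
          simp only [hD, hδdef, ← Finset.sum_add_distrib, ← add_smul, add_sub_cancel]
        rw [h3, Finset.sum_insert heA, hH', hX, hη]
        module
      simp only [h1] at h
      rwa [h2] at h
    have hcount := hhom.sum_compl_sum_superset hA fun F =>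
      (NormedSpace.exp (H + θ • (∑ i ∈ F, Y i - ∑ i ∈ A, Y i))).trace.re
    have hle := hcount.symm.trans_le (Finset.sum_le_sum hIH)
    have hfac : ∑ e ∈ Aᶜ, W (insert e A) * (NormedSpace.exp (H' + X e)).trace.re =
        ((j + 1 : ℕ) * W A) * ∑ e ∈ Aᶜ, W (insert e A) / ((j + 1 : ℕ) * W A) *
          (NormedSpace.exp (H' + X e)).trace.re := by
      rw [Finset.mul_sum]
      refine Finset.sum_congr rfl fun e _ => ?_
      field_simp
    rw [hfac] at hle
    have hfin := hle.trans (mul_le_mul_of_nonneg_left hstep hT.le)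
    rw [mul_assoc] at hfin
    exact le_of_mul_le_mul_left hfin hJ

lemma condIntensity_empty {μ : Finset α → ℝ} (hμ1 : ∑ F, μ F = 1) (i : α) :
    condIntensity μ ∅ i = ∑ F with i ∈ F, μ F := by
  simp [condIntensity, supersetMass, hμ1]

lemma sum_condIntensity_empty_smul {μ : Finset α → ℝ} (hμ1 : ∑ F, μ F = 1) {E : Type*}
    [AddCommGroup E] [Module ℝ E] (Y : α → E) :
    ∑ i, condIntensity μ ∅ i • Y i = ∑ F, μ F • ∑ i ∈ F, Y i := by
  simp only [condIntensity_empty hμ1, Finset.sum_smul, Finset.smul_sum, Finset.sum_filter,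
    ite_smul, zero_smul]
  rw [Finset.sum_comm]
  refine Finset.sum_congr rfl fun F _ => ?_
  rw [← Finset.sum_filter]
  simp

/-- Centred trace exponential moment bound for a homogeneous `ℓ∞`-independent process. -/
lemma sum_trace_exp_smul_sub_le {μ : Finset α → ℝ} (hμ0 : ∀ F, 0 ≤ μ F) (hμ1 : ∑ F, μ F = 1)
    {k : ℕ} (hhom : IsHomogeneous μ k) {d : ℝ} (hind : LinftyIndep μ d) {Y : α → Matrix n n ℂ}
    {r c θ : ℝ} (hr : 0 < r) (hY0 : ∀ i, 0 ≤ Y i) (hYr : ∀ i, Y i ≤ r • 1) (hc1 : r * d ≤ c)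
    (hc2 : r / 2 * (9 * d ^ 2 + 1) ≤ c) (hθ : c * |θ| ≤ 1 / 2) {ES : Matrix n n ℂ}
    (hES : ES = ∑ F, μ F • ∑ i ∈ F, Y i) :
    ∑ F, μ F * (NormedSpace.exp (θ • (∑ i ∈ F, Y i - ES))).trace.re ≤
      (NormedSpace.exp ((c * θ ^ 2) • ES)).trace.re := by
  have hE := (sum_condIntensity_empty_smul hμ1 Y).trans hES.symm
  have hESh : ES.IsHermitian := hE ▸ isHermitian_sum_smul hY0 _
  have h := sum_superset_trace_exp_le hμ0 hhom hind hr hY0 hYr hc1 hc2 hθ k ∅ (by simp)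
    ((-θ) • ES) (IsSelfAdjoint.smul (IsSelfAdjoint.all _) hESh)
  have h1 (F : Finset α) : (-θ) • ES + θ • (∑ i ∈ F, Y i - 0) = θ • (∑ i ∈ F, Y i - ES) := by
    module
  have h2 : (-θ) • ES + (θ + c * θ ^ 2) • (ES - 0) = (c * θ ^ 2) • ES := by module
  have h3 : supersetMass μ ∅ = 1 := by simpa [supersetMass] using hμ1
  rw [hE, h3, one_mul] at h
  simpa only [Finset.sum_empty, h1, h2, Finset.empty_subset, Finset.filter_true] using h

end MomentGeneratingFunction

lemma exp_le_one_add_div_sq_mul {x : ℝ} (hx : 0 < x) :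
    Real.exp x ≤ (1 + 3 / x ^ 2) * (Real.exp x - x - 1) := by
  have h := Real.sum_le_exp_of_nonneg hx.le 5
  simp only [Finset.sum_range_succ, Finset.sum_range_zero, Nat.factorial] at h
  norm_num at h
  have key : (x ^ 2 + 3) * (x + 1) ≤ 3 * Real.exp x := by
    nlinarith [mul_nonneg (sq_nonneg x) (sq_nonneg (1 - x / 2))]
  have h2 : (1 + 3 / x ^ 2) * (Real.exp x - x - 1) - Real.exp x =
      (3 * Real.exp x - (x ^ 2 + 3) * (x + 1)) / x ^ 2 := by
    field_simp
    ring
  have : 0 ≤ (3 * Real.exp x - (x ^ 2 + 3) * (x + 1)) / x ^ 2 :=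
    div_nonneg (by linarith) (by positivity)
  linarith

/-- **Intrinsic Matrix Chernoff bound for ℓ∞-independent homogeneous point processes.** -/
theorem intrinsic_chernoff_homogeneous
    {m d : ℕ} (μ : Finset (Fin m) → ℝ) (hμ0 : ∀ F, 0 ≤ μ F) (hμ1 : ∑ F, μ F = 1)
    (k : ℕ) (hhom : IsHomogeneous μ k)
    (dinf : ℝ) (hind : LinftyIndep μ dinf)
    (Y : Fin m → Matrix (Fin d) (Fin d) ℂ) (r : ℝ) (hr : 0 < r)
    (hY0 : ∀ i, (Y i).PosSemidef)
    (hYr : ∀ i, ((r : ℂ) • (1 : Matrix (Fin d) (Fin d) ℂ) - Y i).PosSemidef)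
    (ES : Matrix (Fin d) (Fin d) ℂ) (hES : ES = ∑ F : Finset (Fin m), μ F • ∑ i ∈ F, Y i)
    (M : Matrix (Fin d) (Fin d) ℂ) (hMh : M.IsHermitian) (hM : M.PosSemidef) (hM0 : M ≠ 0)
    (hEM : (M - ES).PosSemidef)
    (c : ℝ) (hc : c = max (r * dinf) (r / 2 * (9 * dinf ^ 2 + 1)))
    (ε : ℝ) (hε : ε ∈ Set.Ioc (0 : ℝ) 1) :
    (∑ F : Finset (Fin m),
        if ε * opNorm M ≤ opNorm ((∑ i ∈ F, Y i) - ES) then μ F else 0)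
      ≤ 2 * (M.trace.re / opNorm M) *
          (1 + 12 * c ^ 2 / ((opNorm M) ^ 2 * ε ^ 4)) *
          Real.exp (-(ε ^ 2 * opNorm M / (4 * c))) := by
  open scoped MatrixOrder Matrix.Norms.L2Operator in
  obtain ⟨hε0, hε1⟩ := hε
  have hnorm (A : Matrix (Fin d) (Fin d) ℂ) : opNorm A = ‖A‖ := rfl
  simp only [hnorm]
  set κ := ‖M‖ with hκdef
  have hκ : 0 < κ := norm_pos_iff.mpr hM0
  have hc1 : r * dinf ≤ c := hc ▸ le_max_left _ _
  have hc2 : r / 2 * (9 * dinf ^ 2 + 1) ≤ c := hc ▸ le_max_right _ _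
  have hc0 : 0 < c := lt_of_lt_of_le (by positivity) hc2
  have hY0' : ∀ i, 0 ≤ Y i := fun i => (hY0 i).nonneg
  have hYr' : ∀ i, Y i ≤ r • (1 : Matrix (Fin d) (Fin d) ℂ) := fun i => by
    have := hYr i
    rwa [Complex.coe_smul] at this
  set θ := ε / (2 * c) with hθdef
  have hθ0 : 0 < θ := by positivity
  have hθ : c * |θ| ≤ 1 / 2 := by
    rw [abs_of_pos hθ0, hθdef]
    calc c * (ε / (2 * c)) = ε / 2 := by field_simp
      _ ≤ 1 / 2 := by linarith
  set x := θ * (ε * κ) with hxdef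
  have hx : 0 < x := by positivity
  have hx2 : c * θ ^ 2 * κ = x / 2 := by rw [hxdef, hθdef]; field_simp
  have hMnn : 0 ≤ M := hM.nonneg
  have hESM : ES ≤ M := Matrix.le_iff.mpr hEM
  have hYh (i) : (Y i).IsHermitian := (hY0 i).isHermitian
  have hSh (F : Finset (Fin m)) : (∑ i ∈ F, Y i).IsHermitian :=
    isSelfAdjoint_sum _ fun i _ => hYh i
  have hESh : ES.IsHermitian := by
    rw [hES]
    exact isSelfAdjoint_sum _ fun F _ => IsSelfAdjoint.smul (IsSelfAdjoint.all _) (hSh F)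
  set K := M.trace.re / κ * (Real.exp (x / 2) - 1) with hK
  have hmgf {τ : ℝ} (hτ : τ ^ 2 = θ ^ 2) (hτ' : |τ| = |θ|) :
      ∑ F, μ F * ((NormedSpace.exp (τ • (∑ i ∈ F, Y i - ES))).trace.re - (d : ℝ)) ≤ K := by
    have h1 := sum_trace_exp_smul_sub_le hμ0 hμ1 hhom hind hr hY0' hYr' hc1 hc2
      (θ := τ) (by rwa [hτ']) hES
    have h2 := trace_exp_mono (A := (c * τ ^ 2) • ES) (B := (c * τ ^ 2) • M)
      (IsSelfAdjoint.smul (IsSelfAdjoint.all _) hESh)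
      (IsSelfAdjoint.smul (IsSelfAdjoint.all _) hMh)
      (smul_le_smul_of_nonneg_left hESM (by positivity))
    have h3 := trace_exp_smul_sub_card_le hMnn hM0 (c * τ ^ 2)
    rw [← hκdef, hτ, hx2, ← hK, Fintype.card_fin] at h3
    rw [hτ] at h1 h2
    simp only [mul_sub, Finset.sum_sub_distrib, ← Finset.sum_mul, hμ1, one_mul]
    linarith
  set ψ := Real.exp x - x - 1 with hψ
  have hψ0 : 0 < ψ := by linarith [Real.add_one_lt_exp hx.ne']
  have hmarkov : (∑ F : Finset (Fin m), if ε * κ ≤ ‖∑ i ∈ F, Y i - ES‖ then μ F else 0) * ψ ≤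
      2 * K := by
    have h1 := hmgf (τ := θ) rfl rfl
    have h2 := hmgf (τ := -θ) (by ring) (abs_neg θ)
    have h3 : (∑ F : Finset (Fin m), if ε * κ ≤ ‖∑ i ∈ F, Y i - ES‖ then μ F else 0) * ψ ≤
        ∑ F, μ F * ((NormedSpace.exp (θ • (∑ i ∈ F, Y i - ES))).trace.re - (d : ℝ)) +
        ∑ F, μ F * ((NormedSpace.exp ((-θ) • (∑ i ∈ F, Y i - ES))).trace.re - (d : ℝ)) := by
      rw [Finset.sum_mul, ← Finset.sum_add_distrib]
      refine Finset.sum_le_sum fun F _ => ?_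
      rw [← mul_add]
      have hBh : (θ • (∑ i ∈ F, Y i - ES)).IsHermitian :=
        IsSelfAdjoint.smul (IsSelfAdjoint.all _) ((hSh F).sub hESh)
      rw [neg_smul]
      split_ifs with hF
      · refine mul_le_mul_of_nonneg_left ?_ (hμ0 F)
        have := exp_sub_sub_one_le_trace_exp hBh hx (by
          rw [norm_smul, Real.norm_of_nonneg hθ0.le, hxdef]
          gcongr)
        rwa [Fintype.card_fin] at this
      · rw [zero_mul]
        refine mul_nonneg (hμ0 F) ?_
        have := trace_exp_two_sided_nonneg hBh
        rwa [Fintype.card_fin] at this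
    linarith
  have htr : 0 ≤ M.trace.re := (Complex.nonneg_iff.mp hM.trace_nonneg).1
  have hfin := exp_le_one_add_div_sq_mul hx
  have hconst : 12 * c ^ 2 / (κ ^ 2 * ε ^ 4) = 3 / x ^ 2 := by
    rw [hxdef, hθdef]; field_simp; norm_num
  have hexp : ε ^ 2 * κ / (4 * c) = x / 2 := by rw [hxdef, hθdef]; field_simp; norm_num
  rw [hconst, hexp]
  refine le_of_mul_le_mul_right (hmarkov.trans ?_) hψ0
  have hhalf : Real.exp (x / 2) ≤ (1 + 3 / x ^ 2) * ψ * Real.exp (-(x / 2)) := by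
    have h1 := mul_le_mul_of_nonneg_right hfin (Real.exp_pos (-(x / 2))).le
    rwa [← Real.exp_add, show x + -(x / 2) = x / 2 by ring] at h1
  calc 2 * K ≤ 2 * (M.trace.re / κ * ((1 + 3 / x ^ 2) * ψ * Real.exp (-(x / 2)))) := by
        rw [hK]; gcongr; linarith
    _ = _ := by ring
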